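/- An element w of the coset v₃ + M is minimal with respect to ≺ (i.e., there is no w' ∈ v₃ + M with w' ≺ w) if and only if w = v₃ = (−1,−1,−3,−1) or w = v₆ = (−4,2,0,2). -/

import Mathlib

/-- `M = span_ℤ {(−3,3,3,3), (3,−3,3,3), (3,3,−3,3), (3,3,3,−3)}`. -/
def M : Submodule ℤ (Fin 4 → ℤ) :=
  Submodule.span ℤ {![-3, 3, 3, 3], ![3, -3, 3, 3], ![3, 3, -3, 3], ![3, 3, 3, -3]}

/-- The coset representatives `v₀, v₁, v₂, v₃` of `L₁/M`. -/
def v : Fin 4 → (Fin 4 → ℤ) :=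
  ![![-1, 3, -1, 1], ![1, -1, -1, 3], ![3, 1, -1, -1], ![-1, -1, -3, -1]]

/-- The partial preorder `≼` on `ℕ⁴`: `n ≼ n'` iff `Σ_{i ≥ i₀} nᵢ ≤ Σ_{i ≥ i₀} n'ᵢ`
for every `i₀`. -/
def preceq (n n' : Fin 4 → ℕ) : Prop :=
  ∀ i0 : Fin 4, ∑ i ∈ Finset.univ.filter (fun i => i0 ≤ i), n i ≤
    ∑ i ∈ Finset.univ.filter (fun i => i0 ≤ i), n' i

/-- The strict relation `≺`: `n ≺ n'` iff `n ≼ n'` but not `n' ≼ n`. -/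
def precl (n n' : Fin 4 → ℕ) : Prop := preceq n n' ∧ ¬ preceq n' n

/-- `φ : ℤ⁴ → ℕ⁴`, `φ(x) = (x₀², x₁², x₂², x₃²)`. -/
def phi (x : Fin 4 → ℤ) : Fin 4 → ℕ := fun i => (x i).natAbs ^ 2

theorem mem_M_iff (x : Fin 4 → ℤ) : x ∈ M ↔ ∃ a : Fin 4 → ℤ,
    ∀ i, x i = 3 * (a 0 + a 1 + a 2 + a 3) - 6 * a i := by
  simp only [M, Submodule.mem_span_insert, Submodule.mem_span_singleton]
  constructor
  · rintro ⟨a, _, ⟨b, _, ⟨c, _, ⟨d, rfl⟩, rfl⟩, rfl⟩, rfl⟩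
    refine ⟨![a, b, c, d], fun i => ?_⟩
    fin_cases i <;> simp <;> ring
  · rintro ⟨a, h⟩
    refine ⟨a 0, _, ⟨a 1, _, ⟨a 2, _, ⟨a 3, rfl⟩, rfl⟩, rfl⟩, ?_⟩
    ext i
    rw [h i]
    fin_cases i <;> simp <;> ring

theorem preceq_phi_iff (x y : Fin 4 → ℤ) : preceq (phi x) (phi y) ↔
    x 3 ^ 2 ≤ y 3 ^ 2 ∧ x 2 ^ 2 + x 3 ^ 2 ≤ y 2 ^ 2 + y 3 ^ 2 ∧
    x 1 ^ 2 + x 2 ^ 2 + x 3 ^ 2 ≤ y 1 ^ 2 + y 2 ^ 2 + y 3 ^ 2 ∧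
    x 0 ^ 2 + x 1 ^ 2 + x 2 ^ 2 + x 3 ^ 2 ≤ y 0 ^ 2 + y 1 ^ 2 + y 2 ^ 2 + y 3 ^ 2 := by
  simp only [preceq, phi, Fin.forall_fin_succ, Finset.sum_filter, Fin.sum_univ_four]
  zify
  simp [Fin.le_def, sq_abs]
  tauto

theorem preceq_trans {n n' n'' : Fin 4 → ℕ} (h : preceq n n') (h' : preceq n' n'') :
    preceq n n'' := fun i => (h i).trans (h' i)

theorem four_le_sq (z : ℤ) : 4 ≤ (2 + 6 * z) ^ 2 := by
  rcases le_or_gt 0 z with h | h <;> nlinarith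

theorem sixteen_le_sq_of_ne_zero {z : ℤ} (hz : z ≠ 0) : 16 ≤ (2 + 6 * z) ^ 2 := by
  rcases lt_or_gt_of_ne hz with h | h <;> nlinarith

/-- The coset `v₃ + M` splits into two cosets of `6 D₄`. -/
theorem coset_cases {w : Fin 4 → ℤ} (hw : w - v 3 ∈ M) : ∃ z : Fin 4 → ℤ,
    Even (z 0 + z 1 + z 2 + z 3) ∧
    ((∀ i, w i = v 3 i + 6 * z i) ∨ ∀ i, w i = ![-4, 2, 0, 2] i + 6 * z i) := by
  obtain ⟨a, h⟩ := (mem_M_iff _).1 hw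
  obtain ⟨t, ht | ht⟩ := Int.even_or_odd' (a 0 + a 1 + a 2 + a 3)
  · refine ⟨fun i => t - a i, ⟨t, by linarith⟩, .inl fun i => ?_⟩
    have := h i
    rw [Pi.sub_apply] at this
    linarith
  · refine ⟨![t - a 0 + 1, t - a 1, t - a 2, t - a 3], ⟨t, ?_⟩, .inr fun i => ?_⟩
    · simp
      linarith
    · have := h i
      fin_cases i <;> simp [v] at this ⊢ <;> linarith

theorem v3_preceq_and_eq {w z : Fin 4 → ℤ} (hz : Even (z 0 + z 1 + z 2 + z 3))
    (hw : ∀ i, w i = v 3 i + 6 * z i) :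
    preceq (phi (v 3)) (phi w) ∧ (preceq (phi w) (phi (v 3)) → w = v 3) := by
  obtain ⟨k, hk⟩ := hz
  have h0 := Int.le_self_sq (z 0)
  have h1 := Int.le_self_sq (z 1)
  have h2 := Int.le_self_sq (z 2)
  have h3 := Int.le_self_sq (z 3)
  have e0 : v 3 0 = -1 := rfl
  have e1 : v 3 1 = -1 := rfl
  have e2 : v 3 2 = -3 := rfl
  have e3 : v 3 3 = -1 := rfl
  simp only [preceq_phi_iff, hw, e0, e1, e2, e3]
  refine ⟨⟨by nlinarith, by nlinarith, by nlinarith, by nlinarith⟩, fun ⟨g3, g2, g1, g0⟩ => ?_⟩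
  have z3 : z 3 = 0 := by nlinarith
  have z2 : 0 ≤ z 2 ∧ z 2 ≤ 1 := by constructor <;> nlinarith
  have z1 : z 1 = 0 := by nlinarith
  have z0 : z 0 = 0 := by nlinarith
  have z2' : z 2 = 0 := by omega
  ext i
  rw [hw]
  fin_cases i <;> simp [z0, z1, z2', z3]

theorem v6_preceq_and_eq {w z : Fin 4 → ℤ} (hz : Even (z 0 + z 1 + z 2 + z 3))
    (hw : ∀ i, w i = ![-4, 2, 0, 2] i + 6 * z i) :
    preceq (phi ![-4, 2, 0, 2]) (phi w) ∧
      (preceq (phi w) (phi ![-4, 2, 0, 2]) → w = ![-4, 2, 0, 2]) := by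
  obtain ⟨k, hk⟩ := hz
  have e0 : w 0 = 2 + 6 * (z 0 - 1) := by rw [hw]; simp; ring
  have e1 : w 1 = 2 + 6 * z 1 := by simp [hw]
  have e2 : w 2 = 6 * z 2 := by simp [hw]
  have e3 : w 3 = 2 + 6 * z 3 := by simp [hw]
  have h0 : 4 ≤ w 0 ^ 2 := e0 ▸ four_le_sq _
  have h1 : 4 ≤ w 1 ^ 2 := e1 ▸ four_le_sq _
  have h2 : 0 ≤ w 2 ^ 2 := sq_nonneg _
  have h3 : 4 ≤ w 3 ^ 2 := e3 ▸ four_le_sq _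
  have h0' : z 0 = 1 ∨ 16 ≤ w 0 ^ 2 := by
    rw [e0, or_iff_not_imp_left]
    exact fun h => sixteen_le_sq_of_ne_zero (by omega)
  have h1' : z 1 = 0 ∨ 16 ≤ w 1 ^ 2 := by
    rw [e1, or_iff_not_imp_left]
    exact sixteen_le_sq_of_ne_zero
  have h2' : z 2 = 0 ∨ 36 ≤ w 2 ^ 2 := by
    rw [e2, or_iff_not_imp_left]
    intro h
    nlinarith [pow_pos (abs_pos.2 h) 2, sq_abs (z 2)]
  have h3' : z 3 = 0 ∨ 16 ≤ w 3 ^ 2 := by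
    rw [e3, or_iff_not_imp_left]
    exact sixteen_le_sq_of_ne_zero
  simp only [preceq_phi_iff, Matrix.cons_val]
  refine ⟨by omega, fun ⟨g3, g2, g1, g0⟩ => ?_⟩
  have z3 : z 3 = 0 := by omega
  have z2 : z 2 = 0 := by omega
  have z1 : z 1 = 0 := by omega
  have z0 : 0 ≤ z 0 ∧ z 0 ≤ 1 := by
    have : w 0 ^ 2 ≤ 4 ^ 2 := by linarith
    have := abs_le_of_sq_le_sq' this (by norm_num)
    omega
  have z0' : z 0 = 0 := by omega
  ext i
  rw [hw]
  fin_cases i <;> simp [z0', z1, z2, z3]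

theorem preceq_and_eq_of_mem_coset {w : Fin 4 → ℤ} (hw : w - v 3 ∈ M) :
    (preceq (phi (v 3)) (phi w) ∧ (preceq (phi w) (phi (v 3)) → w = v 3)) ∨
    (preceq (phi ![-4, 2, 0, 2]) (phi w) ∧
      (preceq (phi w) (phi ![-4, 2, 0, 2]) → w = ![-4, 2, 0, 2])) := by
  obtain ⟨z, hz, h | h⟩ := coset_cases hw
  · exact .inl (v3_preceq_and_eq hz h)
  · exact .inr (v6_preceq_and_eq hz h)

/-- The minimal vectors of the coset `v₃ + M` with respect to `≺` are exactly
`v₃ = (−1,−1,−3,−1)` and `v₆ = (−4,2,0,2)`. -/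
theorem minimal_vectors_class_v3 (w : Fin 4 → ℤ) (hw : w - v 3 ∈ M) :
    (¬ ∃ w' : Fin 4 → ℤ, w' - v 3 ∈ M ∧ precl (phi w') (phi w)) ↔
      (w = v 3 ∨ w = ![-4, 2, 0, 2]) := by
  have h₃ : v 3 - v 3 ∈ M := by simp
  have h₆ : ![-4, 2, 0, 2] - v 3 ∈ M := by
    refine (mem_M_iff _).2 ⟨![1, 0, 0, 0], fun i => ?_⟩
    fin_cases i <;> simp [v]
  have h₃₆ : ¬ preceq (phi (v 3)) (phi ![-4, 2, 0, 2]) := by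
    rw [preceq_phi_iff]
    simp [v]
  have h₆₃ : ¬ preceq (phi ![-4, 2, 0, 2]) (phi (v 3)) := by
    rw [preceq_phi_iff]
    simp [v]
  constructor
  · intro hmin
    rcases preceq_and_eq_of_mem_coset hw with ⟨hle, heq⟩ | ⟨hle, heq⟩
    · exact .inl (heq (by_contra fun hn => hmin ⟨_, h₃, hle, hn⟩))
    · exact .inr (heq (by_contra fun hn => hmin ⟨_, h₆, hle, hn⟩))
  · rintro (rfl | rfl) ⟨w', hw', hle, hn⟩
    · rcases preceq_and_eq_of_mem_coset hw' with ⟨h, -⟩ | ⟨h, -⟩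
      · exact hn h
      · exact h₆₃ (preceq_trans h hle)
    · rcases preceq_and_eq_of_mem_coset hw' with ⟨h, -⟩ | ⟨h, -⟩
      · exact h₃₆ (preceq_trans h hle)
      · exact hn h
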